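/- Let Γ be an unbalanced signed graph of order n, and let r be an integer with 4 ≤ r ≤ ⌊n/3⌋ + 1. If λ₁(Γ) ≥ λ₁(Γ₁) where Γ₁ = C₃⁻ • K_{n−2}, then Γ contains a negative cycle of length r, unless Γ is switching equivalent to Γ₁. -/

import Mathlib

/-- The largest eigenvalue (index) of a real symmetric matrix. -/
noncomputable def lam1 {n : ℕ} (A : Matrix (Fin n) (Fin n) ℝ) (hA : A.IsHermitian) : ℝ :=
  ⨆ i, hA.eigenvalues i

/-- The sign of a walk in a signed graph: the product of the edge signs along the walk. -/
def walkSign {V : Type*} {G : SimpleGraph V} (σ : V → V → ℝ) {u v : V} (p : G.Walk u v) : ℝ :=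
  (p.darts.map fun d => σ d.toProd.1 d.toProd.2).prod

/-- The adjacency matrix of the signed graph `Γ₁ = C₃⁻ • K_{n−2}`: vertices `0` and `1` are
joined by a negative edge, both are joined positively to vertex `2`, the vertices
`2, 3, …, n−1` form an all-positive clique, and there are no other edges. -/
def gamma1 (n : ℕ) : Matrix (Fin n) (Fin n) ℝ := fun i j =>
  if i = j then 0
  else if (i.val = 0 ∧ j.val = 1) ∨ (i.val = 1 ∧ j.val = 0) then -1
  else if (i.val ≤ 1 ∧ j.val = 2) ∨ (j.val ≤ 1 ∧ i.val = 2) then 1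
  else if 2 ≤ i.val ∧ 2 ≤ j.val then 1
  else 0

section Auxiliary

open Matrix Finset

theorem posSemidef_lam1_sub {n : ℕ} (A : Matrix (Fin n) (Fin n) ℝ) (hA : A.IsHermitian) :
    (lam1 A hA • (1 : Matrix (Fin n) (Fin n) ℝ) - A).PosSemidef := by
  have hU := hA.spectral_theorem
  rw [Unitary.conjStarAlgAut_apply] at hU
  set U : Matrix (Fin n) (Fin n) ℝ := (hA.eigenvectorUnitary : Matrix (Fin n) (Fin n) ℝ) with hUdef
  have hUU : U * star U = 1 := Unitary.coe_mul_star_self hA.eigenvectorUnitary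
  have key : lam1 A hA • (1 : Matrix (Fin n) (Fin n) ℝ) - A =
      U * Matrix.diagonal (fun i => lam1 A hA - hA.eigenvalues i) * star U := by
    have hd : Matrix.diagonal (fun i => lam1 A hA - hA.eigenvalues i) =
        lam1 A hA • (1 : Matrix (Fin n) (Fin n) ℝ) -
          Matrix.diagonal (RCLike.ofReal ∘ hA.eigenvalues) := by
      ext i j
      by_cases h : i = j <;> simp [Matrix.diagonal, h]
    rw [hd, Matrix.mul_sub, Matrix.sub_mul, ← hU]
    simp [hUU]
  rw [key]
  refine Matrix.PosSemidef.mul_mul_conjTranspose_same (Matrix.PosSemidef.diagonal ?_) U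
  intro i
  exact sub_nonneg.2 (le_ciSup (Set.finite_range hA.eigenvalues).bddAbove i)

theorem dotProduct_mulVec_le_lam1 {n : ℕ} (A : Matrix (Fin n) (Fin n) ℝ) (hA : A.IsHermitian)
    (y : Fin n → ℝ) : y ⬝ᵥ (A *ᵥ y) ≤ lam1 A hA * (y ⬝ᵥ y) := by
  have h := (posSemidef_lam1_sub A hA).dotProduct_mulVec_nonneg y
  simp only [star_trivial, Matrix.sub_mulVec, Matrix.smul_mulVec, Matrix.one_mulVec,
    dotProduct_sub, dotProduct_smul, smul_eq_mul] at h
  linarith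

theorem mulVec_eq_of_dotProduct_mulVec_eq {n : ℕ} (A : Matrix (Fin n) (Fin n) ℝ)
    (hA : A.IsHermitian) (y : Fin n → ℝ) (h : y ⬝ᵥ (A *ᵥ y) = lam1 A hA * (y ⬝ᵥ y)) :
    A *ᵥ y = lam1 A hA • y := by
  have h0 := ((posSemidef_lam1_sub A hA).dotProduct_mulVec_zero_iff y).1 (by
    simp only [star_trivial, Matrix.sub_mulVec, Matrix.smul_mulVec, Matrix.one_mulVec,
      dotProduct_sub, dotProduct_smul, smul_eq_mul]
    linarith)
  rw [Matrix.sub_mulVec, Matrix.smul_mulVec, Matrix.one_mulVec] at h0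
  exact (sub_eq_zero.1 h0).symm

theorem exists_mulVec_eq_lam1_smul {n : ℕ} [NeZero n] (A : Matrix (Fin n) (Fin n) ℝ)
    (hA : A.IsHermitian) : ∃ x : Fin n → ℝ, x ≠ 0 ∧ A *ᵥ x = lam1 A hA • x := by
  obtain ⟨i, hi⟩ := exists_eq_ciSup_of_finite (f := hA.eigenvalues)
  refine ⟨⇑(hA.eigenvectorBasis i), ?_, ?_⟩
  · intro h
    apply hA.eigenvectorBasis.toBasis.ne_zero i
    ext j
    simpa using congrFun h j
  · rw [hA.mulVec_eigenvectorBasis, hi]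
    rfl

theorem lt_lam1_gamma1 {n : ℕ} (hn : 9 ≤ n) (hG : (gamma1 n).IsHermitian) :
    (n : ℝ) - 3 < lam1 (gamma1 n) hG := by
  obtain ⟨m, rfl⟩ : ∃ m, n = m + 3 := ⟨n - 3, by omega⟩
  have hm : (6 : ℝ) ≤ m := by exact_mod_cast (by omega : 6 ≤ m)
  have hmod : 2 % (m + 3) = 2 := Nat.mod_eq_of_lt (by omega)
  set ε : ℝ := 1 / (m + 1) with hε
  have hε' : ε * (m + 1) = 1 := by rw [hε]; field_simp
  have hεpos : 0 < ε := by positivity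
  let y : Fin (m + 3) → ℝ := Fin.cons ε (Fin.cons ε (fun _ => 1))
  have hyy : y ⬝ᵥ y = 2 * ε ^ 2 + (m + 1) := by
    simp only [dotProduct, Fin.sum_univ_succ, y, Fin.cons_zero, Fin.cons_succ]
    simp
    ring
  have h0 : (gamma1 (m + 3) *ᵥ y) 0 = 1 - ε := by
    simp only [Matrix.mulVec, dotProduct, Fin.sum_univ_succ, y, Fin.cons_zero, Fin.cons_succ,
      gamma1]
    simp [Fin.ext_iff, hmod]
    ring
  have h1 : (gamma1 (m + 3) *ᵥ y) (Fin.succ 0) = 1 - ε := by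
    simp only [Matrix.mulVec, dotProduct, Fin.sum_univ_succ, y, Fin.cons_zero, Fin.cons_succ,
      gamma1]
    simp [Fin.ext_iff, hmod]
    ring
  have h2 : (gamma1 (m + 3) *ᵥ y) (Fin.succ (Fin.succ 0)) = m + 2 * ε := by
    simp only [Matrix.mulVec, dotProduct, Fin.sum_univ_succ, y, Fin.cons_zero, Fin.cons_succ,
      gamma1]
    simp [Fin.ext_iff, hmod]
    ring
  have h3 : ∀ i : Fin m, (gamma1 (m + 3) *ᵥ y) i.succ.succ.succ = m := by
    intro i
    simp only [Matrix.mulVec, dotProduct, Fin.sum_univ_succ, y, Fin.cons_zero, Fin.cons_succ,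
      gamma1]
    simp [hmod, Finset.sum_ite, Finset.filter_ne]
    rw [if_neg (by simp [Fin.ext_iff, hmod]), Nat.cast_sub (by omega)]
    push_cast
    ring
  have hyAy : y ⬝ᵥ (gamma1 (m + 3) *ᵥ y) = 2 * ε * (1 - ε) + (m + 2 * ε) + m * m := by
    simp only [dotProduct]
    rw [Fin.sum_univ_succ, Fin.sum_univ_succ, Fin.sum_univ_succ]
    rw [h0, h1, h2]
    simp only [h3, y, Fin.cons_zero, Fin.cons_succ]
    simp
    ring
  have := dotProduct_mulVec_le_lam1 (gamma1 (m + 3)) hG y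
  rw [hyAy, hyy] at this
  by_contra! hcon
  push_cast at hcon
  have h5 : lam1 (gamma1 (m + 3)) hG * (2 * ε ^ 2 + (m + 1)) ≤ m * (2 * ε ^ 2 + (m + 1)) :=
    mul_le_mul_of_nonneg_right (by linarith) (by positivity)
  nlinarith [mul_pos hεpos hεpos]

theorem walkSign_eq_mul {V : Type*} {G : SimpleGraph V} {σ : V → V → ℝ} {sw : V → ℝ}
    (hsw : ∀ a, sw a * sw a = 1) (hσ : ∀ a b, G.Adj a b → σ a b = sw a * sw b)
    {u v : V} (p : G.Walk u v) : walkSign σ p = sw u * sw v := by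
  induction p with
  | nil => simp [walkSign, hsw]
  | @cons a b c h p ih =>
    have : walkSign σ (SimpleGraph.Walk.cons h p) = σ a b * walkSign σ p := by
      simp [walkSign]
    rw [this, ih, hσ a b h]
    linear_combination (sw a * sw c) * hsw b

theorem walkSign_mapLe {V : Type*} {G H : SimpleGraph V} (h : H ≤ G) (σ : V → V → ℝ)
    {u v : V} (p : H.Walk u v) : walkSign σ (p.mapLe h) = walkSign σ p := by
  induction p with
  | nil => rfl
  | cons h' p ih =>
    simp only [walkSign, SimpleGraph.Walk.mapLe, SimpleGraph.Walk.map_cons,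
      SimpleGraph.Walk.darts_cons, List.map_cons, List.prod_cons] at ih ⊢
    rw [ih]
    rfl

theorem exists_negative_cycle_of_path {V : Type*} {G H : SimpleGraph V} (hle : H ≤ G)
    {σ : V → V → ℝ} {sw : V → ℝ} (hsw : ∀ a, sw a * sw a = 1)
    (hσ : ∀ a b, H.Adj a b → σ a b = sw a * sw b) {u v : V} (huv : G.Adj u v)
    (hHuv : ¬ H.Adj u v) (hneg : σ u v = -(sw u * sw v)) (p : H.Walk v u) (hp : p.IsPath) :
    ∃ c : G.Walk u u, c.IsCycle ∧ c.length = p.length + 1 ∧ walkSign σ c = -1 := by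
  refine ⟨SimpleGraph.Walk.cons huv (p.mapLe hle), ?_, by simp, ?_⟩
  · rw [SimpleGraph.Walk.cons_isCycle_iff]
    refine ⟨(SimpleGraph.Walk.isPath_mapLe hle).2 hp, ?_⟩
    rw [SimpleGraph.Walk.edges_mapLe_eq_edges]
    exact fun h => hHuv (p.adj_of_mem_edges h)
  · have : walkSign σ (SimpleGraph.Walk.cons huv (p.mapLe hle)) =
        σ u v * walkSign σ (p.mapLe hle) := by simp [walkSign]
    rw [this, walkSign_mapLe, walkSign_eq_mul hsw hσ, hneg]
    linear_combination (-(sw v * sw v)) * hsw u - hsw v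

theorem exists_adj_ne_of_negative_cycle {V : Type*} {G : SimpleGraph V} {σ : V → V → ℝ}
    {sw : V → ℝ} (hsw : ∀ a, sw a * sw a = 1) {v : V} (p : G.Walk v v)
    (hp : walkSign σ p = -1) : ∃ a b, G.Adj a b ∧ σ a b ≠ sw a * sw b := by
  by_contra! h
  rw [walkSign_eq_mul hsw h, hsw] at hp
  norm_num at hp

section PathConstruction

variable {V : Type*} [Fintype V] [DecidableEq V] (H : SimpleGraph V) [DecidableRel H.Adj]

/-- The vertices other than `y` that are not adjacent to `y`. -/
def missing (y : V) : Finset V := {z | z ≠ y ∧ ¬ H.Adj y z}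

variable {H}

theorem mem_missing {y z : V} : z ∈ missing H y ↔ z ≠ y ∧ ¬ H.Adj y z := by
  simp [missing]

theorem eq_of_card_missing_le_one {y a b : V} (hy : #(missing H y) ≤ 1) (ha : a ≠ y)
    (hya : ¬ H.Adj y a) (hb : b ≠ y) (hyb : ¬ H.Adj y b) : a = b :=
  Finset.card_le_one.1 hy a (mem_missing.2 ⟨ha, hya⟩) b (mem_missing.2 ⟨hb, hyb⟩)

theorem adj_of_card_missing_le_two {y a b z : V} (hy : #(missing H y) ≤ 2) (hab : a ≠ b)
    (ha : a ≠ y) (hya : ¬ H.Adj y a) (hb : b ≠ y) (hyb : ¬ H.Adj y b) (hz : z ≠ y)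
    (hza : z ≠ a) (hzb : z ≠ b) : H.Adj y z := by
  by_contra hyz
  have hsub : ({a, b, z} : Finset V) ⊆ missing H y := by
    intro w hw
    simp only [Finset.mem_insert, Finset.mem_singleton] at hw
    rcases hw with rfl | rfl | rfl <;> exact mem_missing.2 ⟨‹_›, ‹_›⟩
  have := Finset.card_le_card hsub
  rw [Finset.card_eq_three.2 ⟨a, b, z, hab, hza.symm, hzb.symm, rfl⟩] at this
  omega

/-- A path can be prolonged greedily inside a set whose vertices miss few of its vertices. -/
theorem exists_path_extension {u : V} (J : ℕ) : ∀ {g : V} (A : Finset V) (p₀ : H.Walk g u),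
    p₀.IsPath → (∀ z ∈ A, z ∉ p₀.support) →
    (∀ y ∈ insert g A, #(A ∩ missing H y) + J ≤ #A) →
    ∃ h ∈ insert g A, (1 ≤ J → h ∈ A) ∧ ∃ p : H.Walk h u, p.IsPath ∧
      p.length = p₀.length + J ∧ ∀ w ∈ p.support, w ∈ p₀.support ∨ w ∈ A := by
  induction J with
  | zero =>
    intro g A p₀ hp₀ _ _
    exact ⟨g, by simp, by omega, p₀, hp₀, by simp, fun w hw => Or.inl hw⟩
  | succ J ih =>
    intro g A p₀ hp₀ hdisj hmiss
    have hg : g ∉ A := fun h => hdisj g h p₀.start_mem_support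
    obtain ⟨z, hzA, hz⟩ : ∃ z ∈ A, z ∉ A ∩ missing H g := by
      by_contra! hcon
      have h1 := Finset.card_le_card (fun z hz => hcon z hz : A ⊆ A ∩ missing H g)
      have h2 := hmiss g (by simp)
      omega
    have hzg : z ≠ g := by rintro rfl; exact hg hzA
    have hgz : H.Adj g z := by
      by_contra h
      exact hz (Finset.mem_inter.2 ⟨hzA, mem_missing.2 ⟨hzg, h⟩⟩)
    obtain ⟨h, hh, -, p, hp, hlen, hsupp⟩ := ih (A.erase z) (SimpleGraph.Walk.cons hgz.symm p₀)
      (hp₀.cons (hdisj z hzA))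
      (by
        intro w hw
        rw [Finset.mem_erase] at hw
        simp only [SimpleGraph.Walk.support_cons, List.mem_cons, not_or]
        exact ⟨hw.1, hdisj w hw.2⟩)
      (by
        intro y hy
        rw [Finset.insert_erase hzA] at hy
        have h1 := hmiss y (Finset.mem_insert_of_mem hy)
        have h2 : #(A.erase z ∩ missing H y) ≤ #(A ∩ missing H y) :=
          Finset.card_le_card (Finset.inter_subset_inter_right (Finset.erase_subset _ _))
        rw [Finset.card_erase_of_mem hzA]
        omega)
    rw [Finset.insert_erase hzA] at hh
    refine ⟨h, Finset.mem_insert_of_mem hh, fun _ => hh, p, hp, ?_, ?_⟩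
    · rw [hlen, SimpleGraph.Walk.length_cons]
      omega
    · intro w hw
      rcases hsupp w hw with hw | hw
      · rw [SimpleGraph.Walk.support_cons, List.mem_cons] at hw
        rcases hw with rfl | hw
        · exact Or.inr hzA
        · exact Or.inl hw
      · exact Or.inr (Finset.mem_of_mem_erase hw)

/-- Two vertices that miss few others are joined by a path with one inner vertex. -/
theorem exists_path_bridge {u v h g : V} (p : H.Walk h u) (hp : p.IsPath)
    (hg : g ∉ p.support) (hv : v ∉ p.support) (hgv : H.Adj g v)
    (hh : #(missing H h) ≤ 2) (hg2 : #(missing H g) ≤ 2)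
    (hcard : p.length + 7 < Fintype.card V) :
    ∃ q : H.Walk v u, q.IsPath ∧ q.length = p.length + 3 := by
  obtain ⟨f, hf⟩ : ∃ f, f ∉ p.support.toFinset ∪ {v, g} ∪ missing H h ∪ missing H g := by
    by_contra! hcon
    have h1 := Finset.eq_univ_of_forall hcon
    have h2 := congrArg Finset.card h1
    rw [Finset.card_univ] at h2
    have h3 := Finset.card_union_le (p.support.toFinset ∪ {v, g} ∪ missing H h) (missing H g)
    have h4 := Finset.card_union_le (p.support.toFinset ∪ {v, g}) (missing H h)
    have h5 := Finset.card_union_le p.support.toFinset {v, g}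
    have h6 := p.support.toFinset_card_le
    rw [SimpleGraph.Walk.length_support] at h6
    have h7 : #({v, g} : Finset V) ≤ 2 := Finset.card_le_two
    omega
  simp only [Finset.mem_union, List.mem_toFinset, Finset.mem_insert, Finset.mem_singleton,
    not_or, mem_missing, not_and, not_not] at hf
  obtain ⟨⟨⟨hfs, hfv, hfg⟩, hfh⟩, hfg'⟩ := hf
  have hfh' : H.Adj h f := hfh (by rintro rfl; exact hfs p.start_mem_support)
  have hgf : H.Adj g f := hfg' hfg
  refine ⟨.cons hgv.symm (.cons hgf (.cons hfh'.symm p)), ?_, by simp⟩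
  simp only [SimpleGraph.Walk.cons_isPath_iff, SimpleGraph.Walk.support_cons, List.mem_cons,
    not_or]
  exact ⟨⟨⟨hp, hfs⟩, Ne.symm hfg, hg⟩, hgv.symm.ne, Ne.symm hfv, hv⟩


/-- A path of length three, unless the graph is special around `u` and `v`. -/
theorem exists_path_of_length_three {u v k : V} (huv : u ≠ v) (hadj : ¬ H.Adj u v)
    (hk : #(missing H k) ≤ 1) (hkv : H.Adj k v) :
    (∃ p : H.Walk v u, p.IsPath ∧ p.length = 3) ∨ (∀ a, H.Adj u a → a = k) ∨
      ∃ z, z ≠ k ∧ ¬ H.Adj k z ∧ H.Adj u z ∧ H.Adj u k ∧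
        (∀ a, H.Adj u a → a = k ∨ a = z) ∧ (∀ b, H.Adj v b → b = k ∨ b = z) := by
  have hpath : ∀ a b, H.Adj u a → H.Adj v b → a ≠ b → H.Adj a b →
      ∃ p : H.Walk v u, p.IsPath ∧ p.length = 3 := by
    intro a b hua hvb hab hadjab
    refine ⟨.cons hvb (.cons hadjab.symm (.cons hua.symm .nil)), ?_, by simp⟩
    have h1 : v ≠ a := by rintro rfl; exact hadj hua
    have h2 : b ≠ u := by rintro rfl; exact hadj hvb.symm
    simp only [SimpleGraph.Walk.cons_isPath_iff, SimpleGraph.Walk.support_cons, List.mem_cons,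
      SimpleGraph.Walk.support_nil, List.not_mem_nil, SimpleGraph.Walk.IsPath.nil]
    simp [hab.symm, h1, h2, huv.symm, hua.ne', hvb.ne]
  by_cases hP : ∀ a, H.Adj u a → a = k
  · exact Or.inr (Or.inl hP)
  push Not at hP
  obtain ⟨z, huz, hzk⟩ := hP
  by_cases hkz : H.Adj k z
  · exact Or.inl (hpath z k huz hkv.symm hzk hkz.symm)
  by_cases hcon : ∃ p : H.Walk v u, p.IsPath ∧ p.length = 3
  · exact Or.inl hcon
  have huk : k ≠ u := by rintro rfl; exact hadj hkv
  have hmiss : ∀ w, w ≠ k → w ≠ z → H.Adj k w := by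
    intro w hwk hwz
    by_contra h
    exact hwz (eq_of_card_missing_le_one hk hwk h hzk hkz)
  have hku : H.Adj k u := hmiss u huk.symm huz.ne
  refine Or.inr (Or.inr ⟨z, hzk, hkz, huz, hku.symm, ?_, ?_⟩)
  · intro a ha
    by_contra! h
    exact hcon (hpath a k ha hkv.symm h.1 (hmiss a h.1 h.2).symm)
  · intro b hb
    by_contra! h
    exact hcon (hpath k b hku.symm hb h.1.symm (hmiss b h.1 h.2))

/-- Many vertices with few non-neighbours force a path of length `s + 1`, unless `u` has no neighbour besides `k`. -/
theorem exists_path_of_sum_le {s : ℕ} (hs : 3 ≤ s) (hcard : 3 * s + 3 ≤ Fintype.card V)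
    (md : V → ℕ) (hmd : ∀ y, #(missing H y) ≤ md y) (hsum : 3 * s + 2 ≤ ∑ j, (3 - md j))
    {u v k : V} (huv : u ≠ v) (hadj : ¬ H.Adj u v) (hu : 2 ≤ md u) (hv : 2 ≤ md v)
    (hP : ∃ a, H.Adj u a) (hk : md k ≤ 1) (hkv : H.Adj k v) :
    (∃ p : H.Walk v u, p.IsPath ∧ p.length = s + 1) ∨ (∀ a, H.Adj u a → a = k) := by
  set S : Finset V := {j | j ≠ u ∧ j ≠ v ∧ md j ≤ 2} with hS
  have memS : ∀ {j}, j ∈ S ↔ j ≠ u ∧ j ≠ v ∧ md j ≤ 2 := by simp [hS]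
  have hsumS : 3 * s ≤ ∑ j ∈ S, (3 - md j) := by
    have h1 : ∑ j, (3 - md j) ≤ ∑ j ∈ insert u (insert v S), (3 - md j) := by
      rw [← Finset.sum_subset (Finset.subset_univ (insert u (insert v S)))]
      intro j _ hj
      simp only [Finset.mem_insert, memS, not_or, not_and] at hj
      have := hj.2.2 hj.1 hj.2.1
      omega
    rw [Finset.sum_insert (by simp [memS, huv]), Finset.sum_insert (by simp [memS])] at h1
    omega
  have hSs : s ≤ #S := by
    have := Finset.sum_le_card_nsmul S (fun j => 3 - md j) 3 (fun j _ => Nat.sub_le _ _)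
    rw [smul_eq_mul] at this
    omega
  have hmdS : ∀ g ∈ S, md g + s ≤ #S + 1 := by
    intro g hg
    have h1 := Finset.sum_le_card_nsmul (S.erase g) (fun j => 3 - md j) 3
      (fun j _ => Nat.sub_le _ _)
    rw [smul_eq_mul, Finset.card_erase_of_mem hg] at h1
    have h2 := Finset.add_sum_erase S (fun j => 3 - md j) hg
    have h3 := (memS.1 hg).2.2
    omega
  have hku : k ≠ u := by rintro rfl; omega
  have hkv' : k ≠ v := hkv.ne
  have hkS : k ∈ S := memS.2 ⟨hku, hkv', by omega⟩
  by_cases hcon : ∃ p : H.Walk v u, p.IsPath ∧ p.length = s + 1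
  · exact Or.inl hcon
  refine Or.inr ?_
  have huS : u ∉ S := by simp [memS]
  have hvS : v ∉ S := by simp [memS]
  have hmissS : ∀ g ∈ S, #(missing H g) ≤ 2 := fun g hg => (hmd g).trans (memS.1 hg).2.2
  have hinter : ∀ (A : Finset V) (y), #(A ∩ missing H y) ≤ md y := fun A y =>
    (Finset.card_le_card Finset.inter_subset_right).trans (hmd y)
  -- two distinct good vertices, one next to `u` and the other next to `v`, give a path
  have hdistinct : ∀ g₁ ∈ S, ∀ g₂ ∈ S, H.Adj u g₁ → H.Adj g₂ v → g₁ = g₂ := by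
    intro g₁ hg₁ g₂ hg₂ h₁ h₂
    by_contra hne
    obtain ⟨h, hh, -, p, hp, hlen, hsupp⟩ := exists_path_extension (s - 3)
      ((S.erase g₂).erase g₁) (SimpleGraph.Walk.cons h₁.symm .nil)
      (by simp [SimpleGraph.Walk.cons_isPath_iff, h₁.ne'])
      (by
        intro z hz
        simp only [Finset.mem_erase] at hz
        simp only [SimpleGraph.Walk.support_cons, SimpleGraph.Walk.support_nil, List.mem_cons,
          List.not_mem_nil, or_false, not_or]
        exact ⟨hz.1, by rintro rfl; exact huS hz.2.2⟩)
      (by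
        intro y hy
        rw [Finset.insert_erase (by simp [hne, hg₁]), Finset.mem_erase] at hy
        rw [Finset.card_erase_of_mem (by simp [hne, hg₁]), Finset.card_erase_of_mem hg₂]
        have := hinter ((S.erase g₂).erase g₁) y
        have := hmdS y hy.2
        omega)
    rw [Finset.insert_erase (by simp [hne, hg₁]), Finset.mem_erase] at hh
    have hlen' : p.length = s - 2 := by
      rw [hlen, SimpleGraph.Walk.length_cons, SimpleGraph.Walk.length_nil]
      omega
    have hnot : ∀ w, w ≠ g₁ → w ≠ u → (w = g₂ ∨ w ∉ S) → w ∉ p.support := by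
      intro w hw1 hwu hw2 hw
      rcases hsupp w hw with hw | hw
      · simp [hw1, hwu] at hw
      · simp only [Finset.mem_erase] at hw
        rcases hw2 with hw2 | hw2
        · exact hw.2.1 hw2
        · exact hw2 hw.2.2
    obtain ⟨q, hq, hql⟩ := exists_path_bridge p hp
      (hnot g₂ (Ne.symm hne) (by rintro rfl; exact huS hg₂) (Or.inl rfl))
      (hnot v (by rintro rfl; exact hvS hg₁) huv.symm (Or.inr hvS)) h₂ (hmissS h hh.2)
      (hmissS g₂ hg₂) (by omega)
    exact hcon ⟨q, hq, by omega⟩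
  by_contra! hex
  obtain ⟨a, hua, hak⟩ := hex
  have haS : a ∉ S := fun h => hak (hdistinct a h k hkS hua hkv)
  have hav : a ≠ v := by rintro rfl; exact hadj hua
  by_cases hQ : ∃ g ∈ S, g ≠ k ∧ H.Adj g v
  · obtain ⟨g, hgS, hgk, hgv⟩ := hQ
    have hnku : ¬ H.Adj k u := fun h => hgk (hdistinct k hkS g hgS h.symm hgv).symm
    have hkadj : ∀ w, w ≠ k → w ≠ u → H.Adj k w := by
      intro w hwk hwu
      by_contra h
      exact hwu (eq_of_card_missing_le_one ((hmd k).trans hk) hwk h hku.symm hnku)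
    have hka : H.Adj k a := hkadj a hak hua.ne'
    have hgu : g ≠ u := by rintro rfl; exact huS hgS
    have hga : g ≠ a := by rintro rfl; exact haS hgS
    rcases Nat.lt_or_ge 3 s with hs4 | hs3
    · obtain ⟨h, hh, -, p, hp, hlen, hsupp⟩ := exists_path_extension (s - 4)
        ((S.erase g).erase k) (SimpleGraph.Walk.cons hka (.cons hua.symm .nil))
        (by simp [SimpleGraph.Walk.cons_isPath_iff, hua.ne', hku, hak.symm])
        (by
          intro z hz
          simp only [Finset.mem_erase] at hz
          simp only [SimpleGraph.Walk.support_cons, SimpleGraph.Walk.support_nil, List.mem_cons,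
            List.not_mem_nil, or_false, not_or]
          exact ⟨hz.1, by rintro rfl; exact haS hz.2.2, by rintro rfl; exact huS hz.2.2⟩)
        (by
          intro y hy
          rw [Finset.insert_erase (by simp [hgk.symm, hkS]), Finset.mem_erase] at hy
          rw [Finset.card_erase_of_mem (by simp [hgk.symm, hkS]),
            Finset.card_erase_of_mem hgS]
          have := hinter ((S.erase g).erase k) y
          have := hmdS y hy.2
          omega)
      rw [Finset.insert_erase (by simp [hgk.symm, hkS]), Finset.mem_erase] at hh
      have hlen' : p.length = s - 2 := by
        rw [hlen]
        simp only [SimpleGraph.Walk.length_cons, SimpleGraph.Walk.length_nil]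
        omega
      have hnot : ∀ w, w ≠ k → w ≠ a → w ≠ u → (w = g ∨ w ∉ S) → w ∉ p.support := by
        intro w hw1 hwa hwu hw2 hw
        rcases hsupp w hw with hw | hw
        · simp [hw1, hwa, hwu] at hw
        · simp only [Finset.mem_erase] at hw
          rcases hw2 with hw2 | hw2
          · exact hw.2.1 hw2
          · exact hw2 hw.2.2
      obtain ⟨q, hq, hql⟩ := exists_path_bridge p hp (hnot g hgk hga hgu (Or.inl rfl))
        (hnot v hkv'.symm hav.symm huv.symm (Or.inr hvS)) hgv (hmissS h hh.2)
        (hmissS g hgS) (by omega)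
      exact hcon ⟨q, hq, by omega⟩
    · refine hcon ⟨.cons hgv.symm (.cons (hkadj g hgk hgu).symm
        (.cons hka (.cons hua.symm .nil))), ?_, by simp; omega⟩
      simp only [SimpleGraph.Walk.cons_isPath_iff, SimpleGraph.Walk.support_cons,
        List.mem_cons, SimpleGraph.Walk.support_nil, List.not_mem_nil,
        SimpleGraph.Walk.IsPath.nil]
      simp [hua.ne', hak.symm, hku, hgk, hga, hgu, hgv.ne', hkv'.symm, hav.symm, huv.symm]
  · push Not at hQ
    have hgood : ∀ g ∈ S, g ≠ k → ∀ w, w ≠ g → w ≠ u → w ≠ v → H.Adj g w := by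
      intro g hgS hgk w hwg hwu hwv
      have hg := memS.1 hgS
      exact adj_of_card_missing_le_two (hmissS g hgS) huv hg.1.symm
        (fun h => hgk (hdistinct g hgS k hkS h.symm hkv)) hg.2.1.symm (hQ g hgS hgk)
        hwg hwu hwv
    have hempty : ∀ y ∈ insert a (S.erase k), S.erase k ∩ missing H y = ∅ := by
      intro y hy
      ext z
      simp only [Finset.mem_inter, Finset.mem_erase, mem_missing, Finset.notMem_empty,
        iff_false, not_and, not_not]
      intro hz hzy
      have hyu : y ≠ u ∧ y ≠ v := by
        rcases Finset.mem_insert.1 hy with rfl | hy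
        · exact ⟨hua.ne', hav⟩
        · have := memS.1 (Finset.mem_of_mem_erase hy)
          exact ⟨this.1, this.2.1⟩
      exact (hgood z hz.2 hz.1 y hzy.symm hyu.1 hyu.2).symm
    obtain ⟨h, -, hhA, p, hp, hlen, hsupp⟩ := exists_path_extension (s - 2)
      (S.erase k) (SimpleGraph.Walk.cons hua.symm .nil)
      (by simp [SimpleGraph.Walk.cons_isPath_iff, hua.ne'])
      (by
        intro z hz
        simp only [Finset.mem_erase] at hz
        simp only [SimpleGraph.Walk.support_cons, SimpleGraph.Walk.support_nil, List.mem_cons,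
          List.not_mem_nil, or_false, not_or]
        exact ⟨by rintro rfl; exact haS hz.2, by rintro rfl; exact huS hz.2⟩)
      (by
        intro y hy
        rw [hempty y hy, Finset.card_empty, Finset.card_erase_of_mem hkS]
        omega)
    have hh := Finset.mem_erase.1 (hhA (by omega))
    have hnot : ∀ w, w ≠ a → w ≠ u → (w = k ∨ w ∉ S) → w ∉ p.support := by
      intro w hwa hwu hw2 hw
      rcases hsupp w hw with hw | hw
      · simp [hwa, hwu] at hw
      · simp only [Finset.mem_erase] at hw
        rcases hw2 with hw2 | hw2
        · exact hw.1 hw2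
        · exact hw2 hw.2
    refine hcon ⟨.cons hkv.symm (.cons (hgood h hh.2 hh.1 k hh.1.symm hku hkv').symm p), ?_, ?_⟩
    · simp only [SimpleGraph.Walk.cons_isPath_iff, SimpleGraph.Walk.support_cons,
        List.mem_cons, not_or]
      exact ⟨⟨hp, hnot k hak.symm hku (Or.inl rfl)⟩, hkv'.symm,
        hnot v hav.symm huv.symm (Or.inr hvS)⟩
    · simp only [SimpleGraph.Walk.length_cons, hlen, SimpleGraph.Walk.length_nil]
      omega

end PathConstruction

section PositiveEigenvector

variable {n : ℕ} {B : Matrix (Fin n) (Fin n) ℝ} {x : Fin n → ℝ} {μ : ℝ}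

/-- The positive part of a signed adjacency matrix, as a graph. -/
def positiveGraph (B : Matrix (Fin n) (Fin n) ℝ) : SimpleGraph (Fin n) where
  Adj i j := i ≠ j ∧ B i j = 1 ∧ B j i = 1
  symm := ⟨fun _ _ h => ⟨h.1.symm, h.2.2, h.2.1⟩⟩
  loopless := ⟨fun _ h => h.1 rfl⟩

theorem positiveGraph_adj_iff (hB0 : ∀ i, B i i = 0) (hBs : ∀ i j, B i j = B j i) {i j : Fin n} :
    (positiveGraph B).Adj i j ↔ B i j = 1 := by
  refine ⟨fun h => h.2.1, fun h => ⟨?_, h, hBs i j ▸ h⟩⟩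
  rintro rfl
  rw [hB0] at h
  norm_num at h

open Classical in
/-- The contribution of a pair of vertices to the deficiency: `0` for a positive edge,
`1` for a missing edge and `2` for a negative edge. -/
noncomputable def pairDeficiency (B : Matrix (Fin n) (Fin n) ℝ) (i j : Fin n) : ℕ :=
  if i = j ∨ B i j = 1 then 0 else if B i j = 0 then 1 else 2

/-- The number of non-neighbours of a vertex, negative neighbours being counted twice. -/
noncomputable def deficiency (B : Matrix (Fin n) (Fin n) ℝ) (j : Fin n) : ℕ :=
  ∑ i, pairDeficiency B i j

theorem pairDeficiency_cast (hB0 : ∀ i, B i i = 0)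
    (hBv : ∀ i j, B i j = 0 ∨ B i j = 1 ∨ B i j = -1) (i j : Fin n) :
    (pairDeficiency B i j : ℝ) = 1 - (if i = j then 1 else 0) - B i j := by
  unfold pairDeficiency
  by_cases hij : i = j
  · subst hij
    simp [hB0]
  · rcases hBv i j with h | h | h <;> norm_num [hij, h]

theorem card_missing_le_deficiency [DecidableRel (positiveGraph B).Adj] (hB0 : ∀ i, B i i = 0)
    (hBs : ∀ i j, B i j = B j i) (y : Fin n) :
    #(missing (positiveGraph B) y) ≤ deficiency B y := by
  rw [Finset.card_eq_sum_ones, deficiency]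
  refine (Finset.sum_le_sum fun z hz => ?_).trans
    (Finset.sum_le_sum_of_subset (Finset.subset_univ _))
  rw [mem_missing, positiveGraph_adj_iff hB0 hBs, hBs] at hz
  unfold pairDeficiency
  rw [if_neg (by tauto)]
  split_ifs <;> omega

theorem two_le_deficiency (hB0 : ∀ i, B i i = 0) {i j : Fin n} (h : B i j = -1) :
    2 ≤ deficiency B j := by
  have h1 : pairDeficiency B i j = 2 := by
    have : i ≠ j := by
      rintro rfl
      rw [hB0] at h
      norm_num at h
    unfold pairDeficiency
    rw [if_neg (by simp [this, h]; norm_num), if_neg (by simp [h])]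
  rw [← h1]
  exact Finset.single_le_sum (f := fun i => pairDeficiency B i j) (fun _ _ => Nat.zero_le _)
    (Finset.mem_univ i)

theorem mul_le_of_entry (hBv : ∀ i j, B i j = 0 ∨ B i j = 1 ∨ B i j = -1) (hx0 : ∀ i, 0 ≤ x i)
    (i j : Fin n) : B i j * x j ≤ x j := by
  have := hx0 j
  rcases hBv i j with h | h | h <;> rw [h] <;> linarith

theorem mul_nonpos_of_entry_ne_one (hBv : ∀ i j, B i j = 0 ∨ B i j = 1 ∨ B i j = -1)
    (hx0 : ∀ i, 0 ≤ x i) {i j : Fin n} (h1 : B i j ≠ 1) : B i j * x j ≤ 0 := by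
  have := hx0 j
  rcases hBv i j with h | h | h
  · simp [h]
  · exact absurd h h1
  · rw [h]
    linarith

theorem lt_sum_of_eigenvector (hB0 : ∀ i, B i i = 0)
    (hBv : ∀ i j, B i j = 0 ∨ B i j = 1 ∨ B i j = -1) (hx0 : ∀ i, 0 ≤ x i)
    {m : Fin n} (hm : x m = 1) (hev : ∀ i, ∑ j, B i j * x j = μ * x i)
    (hμ : (n : ℝ) - 3 < μ) : (n : ℝ) - 2 < ∑ j, x j := by
  have h : ∑ j, B m j * x j ≤ ∑ j, (x j - if j = m then 1 else 0) := by
    refine Finset.sum_le_sum fun j _ => ?_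
    by_cases hj : j = m
    · subst hj
      simp [hB0, hm]
    · simpa [hj] using mul_le_of_entry hBv hx0 m j
  rw [hev, hm, Finset.sum_sub_distrib, Finset.sum_ite_eq' Finset.univ m] at h
  simp only [Finset.mem_univ, if_true] at h
  linarith

theorem sum_mul_deficiency (hB0 : ∀ i, B i i = 0)
    (hBv : ∀ i j, B i j = 0 ∨ B i j = 1 ∨ B i j = -1)
    (hev : ∀ i, ∑ j, B i j * x j = μ * x i) :
    ∑ j, x j * ((deficiency B j : ℝ) - 2) = (n - 3 - μ) * ∑ j, x j := by
  have h1 : ∑ j, x j * (deficiency B j : ℝ) = ∑ i, ∑ j, x j * (pairDeficiency B i j : ℝ) := by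
    rw [Finset.sum_comm]
    simp [deficiency, Finset.mul_sum]
  have h2 : ∀ i, ∑ j, x j * (pairDeficiency B i j : ℝ) = (∑ j, x j) - x i - μ * x i := by
    intro i
    rw [← hev i]
    simp only [pairDeficiency_cast hB0 hBv, mul_comm (x _), sub_mul, one_mul, ite_mul, zero_mul,
      Finset.sum_sub_distrib, Finset.sum_ite_eq, Finset.mem_univ, if_true]
  simp only [mul_sub, Finset.sum_sub_distrib, ← Finset.sum_mul, h1, h2, ← Finset.mul_sum]
  simp
  ring

theorem exists_deficiency_le_one (hB0 : ∀ i, B i i = 0)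
    (hBv : ∀ i j, B i j = 0 ∨ B i j = 1 ∨ B i j = -1) (hx0 : ∀ i, 0 ≤ x i)
    (hev : ∀ i, ∑ j, B i j * x j = μ * x i) (hμ : (n : ℝ) - 3 < μ) (hS : 0 < ∑ j, x j) :
    ∃ k, deficiency B k ≤ 1 := by
  by_contra! h
  have h1 : 0 ≤ ∑ j, x j * ((deficiency B j : ℝ) - 2) := by
    refine Finset.sum_nonneg fun j _ => mul_nonneg (hx0 j) ?_
    have : (2 : ℝ) ≤ deficiency B j := by exact_mod_cast h j
    linarith
  rw [sum_mul_deficiency hB0 hBv hev] at h1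
  nlinarith

theorem le_sum_three_sub_deficiency (hB0 : ∀ i, B i i = 0)
    (hBv : ∀ i j, B i j = 0 ∨ B i j = 1 ∨ B i j = -1) (hx0 : ∀ i, 0 ≤ x i) (hx1 : ∀ i, x i ≤ 1)
    (hev : ∀ i, ∑ j, B i j * x j = μ * x i) (hμ : (n : ℝ) - 3 < μ) (hn : 2 ≤ n)
    (hS : (n : ℝ) - 2 < ∑ j, x j) : n - 1 ≤ ∑ j, (3 - deficiency B j) := by
  have hn' : (2 : ℝ) ≤ n := by exact_mod_cast hn
  have h1 : ∑ j, (x j - ((3 - deficiency B j : ℕ) : ℝ)) ≤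
      ∑ j, x j * ((deficiency B j : ℝ) - 2) := by
    refine Finset.sum_le_sum fun j _ => ?_
    rcases le_total (deficiency B j) 3 with h | h
    · rw [Nat.cast_sub h]
      have : (deficiency B j : ℝ) ≤ 3 := by exact_mod_cast h
      push_cast
      nlinarith [mul_nonneg (sub_nonneg.2 this) (sub_nonneg.2 (hx1 j))]
    · rw [Nat.sub_eq_zero_of_le h]
      have : (3 : ℝ) ≤ deficiency B j := by exact_mod_cast h
      push_cast
      nlinarith [mul_nonneg (sub_nonneg.2 this) (hx0 j)]
  rw [sum_mul_deficiency hB0 hBv hev, Finset.sum_sub_distrib, ← Nat.cast_sum] at h1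
  have h2 : ((n : ℝ) - 3 - μ) * ∑ j, x j < 0 := by nlinarith
  have h3 : ((n - 2 : ℕ) : ℝ) < ((∑ j, (3 - deficiency B j) : ℕ) : ℝ) := by
    rw [Nat.cast_sub hn]
    push_cast at h1 ⊢
    linarith
  have h4 := Nat.cast_lt.1 h3
  omega

theorem exists_entry_eq_one_of_neg (hBv : ∀ i j, B i j = 0 ∨ B i j = 1 ∨ B i j = -1)
    (hx0 : ∀ i, 0 ≤ x i) (hx1 : ∀ i, x i ≤ 1)
    (hev : ∀ i, ∑ j, B i j * x j = μ * x i) (hμ : 0 < μ)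
    (hS : (n : ℝ) - 2 < ∑ j, x j) {u v : Fin n} (huv : u ≠ v) (hneg : B u v = -1) :
    ∃ a, B u a = 1 := by
  by_contra! h
  have h1 : ∑ j, B u j * x j ≤ ∑ j, -(if j = v then x j else 0) := by
    refine Finset.sum_le_sum fun j _ => ?_
    by_cases hj : j = v
    · subst hj
      simp [hneg]
    · simpa [hj] using mul_nonpos_of_entry_ne_one hBv hx0 (h j)
  rw [hev, Finset.sum_neg_distrib, Finset.sum_ite_eq' Finset.univ v] at h1
  simp only [Finset.mem_univ, if_true] at h1
  have hu : x u = 0 := by nlinarith [hx0 u, hx0 v, mul_nonneg hμ.le (hx0 u)]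
  have hv : x v = 0 := by
    rw [hu] at h1
    linarith [hx0 v]
  have h2 : ∑ j, x j ≤ ∑ j, ((1 : ℝ) - (if j = u then 1 else 0) - (if j = v then 1 else 0)) := by
    refine Finset.sum_le_sum fun j _ => ?_
    by_cases hju : j = u
    · subst hju
      simp [hu, huv]
    · by_cases hjv : j = v
      · subst hjv
        simp [hv, huv.symm]
      · simpa [hju, hjv] using hx1 j
  simp [Finset.sum_sub_distrib] at h2
  linarith

theorem false_of_few_positive_neighbours (hB0 : ∀ i, B i i = 0)
    (hBs : ∀ i j, B i j = B j i)
    (hBv : ∀ i j, B i j = 0 ∨ B i j = 1 ∨ B i j = -1) (hx0 : ∀ i, 0 ≤ x i)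
    (hev : ∀ i, ∑ j, B i j * x j = μ * x i) (hμ : (n : ℝ) - 3 < μ) (hn : 9 ≤ n)
    (hS : 0 < ∑ j, x j) {u v k z : Fin n} (huv : u ≠ v) (huk : u ≠ k) (huz : u ≠ z)
    (hvk : v ≠ k) (hvz : v ≠ z) (hzk : z ≠ k) (hneg : B u v = -1) (hkz : B k z ≠ 1)
    (hu : ∀ a, B u a = 1 → a = k ∨ a = z) (hv : ∀ b, B v b = 1 → b = k ∨ b = z) : False := by
  have hn' : (9 : ℝ) ≤ n := by exact_mod_cast hn
  have hend : ∀ u v : Fin n, v ≠ k → v ≠ z → B u v = -1 →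
      (∀ a, B u a = 1 → a = k ∨ a = z) → μ * x u ≤ x k + x z - x v := by
    intro u v hvk hvz hneg hu
    have h1 : ∑ j, B u j * x j ≤ ∑ j, ((if j = k then x j else 0) + (if j = z then x j else 0)
        - (if j = v then x j else 0)) := by
      refine Finset.sum_le_sum fun j _ => ?_
      by_cases hjk : j = k
      · subst hjk
        simpa [hzk.symm, hvk.symm] using mul_le_of_entry hBv hx0 u j
      by_cases hjz : j = z
      · subst hjz
        simpa [hzk, hvz.symm] using mul_le_of_entry hBv hx0 u j
      by_cases hjv : j = v
      · subst hjv
        simp [hneg, hjk, hjz]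
      · have : B u j ≠ 1 := fun h => (hu j h).elim hjk hjz
        simpa [hjk, hjz, hjv] using mul_nonpos_of_entry_ne_one hBv hx0 this
    rw [hev] at h1
    simpa [Finset.sum_add_distrib, Finset.sum_sub_distrib] using h1
  have htwo : ∀ i p q : Fin n, p ≠ q → B i p * x p ≤ 0 → B i q * x q ≤ 0 →
      μ * x i ≤ ∑ j, x j - x p - x q := by
    intro i p q hpq hp hq
    have h1 : ∑ j, B i j * x j ≤ ∑ j, (x j - (if j = p then x j else 0)
        - (if j = q then x j else 0)) := by
      refine Finset.sum_le_sum fun j _ => ?_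
      by_cases hjp : j = p
      · subst hjp
        simpa [hpq] using hp
      by_cases hjq : j = q
      · subst hjq
        simpa [hpq.symm] using hq
      · simpa [hjp, hjq] using mul_le_of_entry hBv hx0 i j
    rw [hev] at h1
    simpa [Finset.sum_sub_distrib] using h1
  have hu1 := hend u v hvk hvz hneg hu
  have hv1 := hend v u huk huz (by rw [hBs, hneg]) hv
  have hk1 := htwo k k z hzk.symm (by simp [hB0])
    (mul_nonpos_of_entry_ne_one hBv hx0 hkz)
  have hz1 := htwo z k z hzk.symm
    (mul_nonpos_of_entry_ne_one hBv hx0 (by rwa [hBs])) (by simp [hB0])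
  set T : Finset (Fin n) := (((Finset.univ.erase u).erase v).erase k).erase z with hT
  have hTcard : (#T : ℝ) = n - 4 := by
    rw [hT, Finset.card_erase_of_mem (by simp [huz.symm, hvz.symm, hzk]),
      Finset.card_erase_of_mem (by simp [huk.symm, hvk.symm]),
      Finset.card_erase_of_mem (by simp [huv.symm]), Finset.card_erase_of_mem (by simp),
      Finset.card_univ, Fintype.card_fin, show n - 1 - 1 - 1 - 1 = n - 4 by omega,
      Nat.cast_sub (by omega)]
    norm_num
  have hTsum : ∑ j, x j = x u + x v + x k + x z + ∑ j ∈ T, x j := by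
    rw [hT, ← Finset.add_sum_erase Finset.univ x (Finset.mem_univ u),
      ← Finset.add_sum_erase _ x (by simp [huv.symm] : v ∈ Finset.univ.erase u),
      ← Finset.add_sum_erase _ x (by simp [huk.symm, hvk.symm] :
        k ∈ (Finset.univ.erase u).erase v),
      ← Finset.add_sum_erase _ x (by simp [huz.symm, hvz.symm, hzk] :
        z ∈ ((Finset.univ.erase u).erase v).erase k)]
    ring
  have hTle : μ * ∑ j ∈ T, x j + ∑ j ∈ T, x j ≤ (n - 4) * (∑ j, x j - x u - x v) := by
    rw [← hTcard, ← nsmul_eq_mul, Finset.mul_sum, ← Finset.sum_add_distrib]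
    refine Finset.sum_le_card_nsmul T _ _ fun i hi => ?_
    simp only [hT, Finset.mem_erase, Finset.mem_univ, and_true] at hi
    have h3 : ∑ j, B i j * x j ≤ ∑ j, (x j - (if j = u then x j else 0)
        - (if j = v then x j else 0) - (if j = i then x j else 0)) := by
      refine Finset.sum_le_sum fun j _ => ?_
      by_cases hju : j = u
      · subst hju
        have : B i j ≠ 1 := fun h => (hu i (by rwa [hBs])).elim hi.2.1 hi.1
        simpa [huv, Ne.symm hi.2.2.2] using mul_nonpos_of_entry_ne_one hBv hx0 this
      by_cases hjv : j = v
      · subst hjv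
        have : B i j ≠ 1 := fun h => (hv i (by rwa [hBs])).elim hi.2.1 hi.1
        simpa [huv.symm, Ne.symm hi.2.2.1] using mul_nonpos_of_entry_ne_one hBv hx0 this
      by_cases hji : j = i
      · subst hji
        simp [hB0, hju, hjv]
      · simpa [hju, hjv, hji] using mul_le_of_entry hBv hx0 i j
    rw [hev] at h3
    simp [Finset.sum_sub_distrib] at h3
    linarith
  have hT0 : 0 ≤ ∑ j ∈ T, x j := Finset.sum_nonneg fun j _ => hx0 j
  have hσ0 : 0 ≤ x u + x v := add_nonneg (hx0 u) (hx0 v)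
  have hτ0 : 0 ≤ x k + x z := add_nonneg (hx0 k) (hx0 z)
  generalize ∑ j ∈ T, x j = Y at *
  generalize ∑ j, x j = S at *
  have e1 : 2 * Y ≤ (n - 4) * (x k + x z) := by
    nlinarith [mul_nonneg (sub_nonneg.2 hμ.le) hT0]
  have e2 : x k + x z ≤ 2 * (x u + x v) := by
    nlinarith [mul_nonneg (sub_nonneg.2 hμ.le) hτ0]
  have e3 : x u + x v ≤ 0 := by nlinarith [mul_nonneg (sub_nonneg.2 hμ.le) hσ0]
  have e4 : x k + x z = 0 := by linarith
  rw [e4] at e1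
  linarith

end PositiveEigenvector

section ExtremalGraph

/-- Nonnegative eigenvectors of a clique with an unbalanced triangle `u v k` attached at `k`
are positive. -/
theorem pos_of_pendant_triangle_eigenvector {n : ℕ} {C : Matrix (Fin n) (Fin n) ℝ}
    {x : Fin n → ℝ} {ν : ℝ} (hx0 : ∀ i, 0 ≤ x i) (hx : x ≠ 0)
    (hrow : ∀ i, ∑ j, C i j * x j = ν * x i) (hν : 1 < ν) {u v k : Fin n}
    (huk : u ≠ k) (hvk : v ≠ k)
    (hrest : ∀ i j, i ≠ u → i ≠ v → j ≠ u → j ≠ v → i ≠ j → C i j = 1)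
    (hnonneg : ∀ i j, i ≠ u → i ≠ v → 0 ≤ C i j)
    (hu : ∀ j, C u j = (if j = k then 1 else 0) - (if j = v then 1 else 0))
    (hv : ∀ j, C v j = (if j = k then 1 else 0) - (if j = u then 1 else 0)) (i : Fin n) :
    0 < x i := by
  have rowu : x k - x v = ν * x u := by
    rw [← hrow u]
    simp [hu, sub_mul, Finset.sum_sub_distrib]
  have rowv : x k - x u = ν * x v := by
    rw [← hrow v]
    simp [hv, sub_mul, Finset.sum_sub_distrib]
  have hclique : ∀ i, i ≠ u → i ≠ v → x i ≠ 0 := by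
    intro i hiu hiv hi
    have h1 := hrow i
    rw [hi, mul_zero, Finset.sum_eq_zero_iff_of_nonneg
      (fun j _ => mul_nonneg (hnonneg i j hiu hiv) (hx0 j))] at h1
    have h2 : ∀ j, j ≠ u → j ≠ v → x j = 0 := by
      intro j hju hjv
      by_cases hij : i = j
      · rw [← hij, hi]
      · simpa [hrest i j hiu hiv hju hjv hij] using h1 j (Finset.mem_univ j)
    have hk := h2 k huk.symm hvk.symm
    rw [hk] at rowu rowv
    have hu0 : x u = 0 := by nlinarith [hx0 u, hx0 v]
    have hv0 : x v = 0 := by nlinarith [hx0 u, hx0 v]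
    apply hx
    funext j
    by_cases hju : j = u
    · rw [hju, hu0, Pi.zero_apply]
    by_cases hjv : j = v
    · rw [hjv, hv0, Pi.zero_apply]
    · rw [h2 j hju hjv, Pi.zero_apply]
  have hk0 := hclique k huk.symm hvk.symm
  refine lt_of_le_of_ne (hx0 i) (Ne.symm ?_)
  by_cases hiu : i = u
  · rw [hiu]
    intro h
    rw [h] at rowu rowv
    have : (ν - 1) * x v = 0 := by linarith
    rcases mul_eq_zero.1 this with h' | h'
    · linarith
    · apply hk0
      linarith
  by_cases hiv : i = v
  · rw [hiv]
    intro h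
    rw [h] at rowu rowv
    have : (ν - 1) * x u = 0 := by linarith
    rcases mul_eq_zero.1 this with h' | h'
    · linarith
    · apply hk0
      linarith
  exact hclique i hiu hiv

theorem exists_equiv_apply_three {n : ℕ} {u v k a b c : Fin n} (huv : u ≠ v) (huk : u ≠ k)
    (hvk : v ≠ k) (hab : a ≠ b) (hac : a ≠ c) (hbc : b ≠ c) :
    ∃ e : Fin n ≃ Fin n, e u = a ∧ e v = b ∧ e k = c := by
  set e₁ := Equiv.swap u a with he₁
  have h1u : e₁ u = a := by simp [he₁]
  have h1v : e₁ v ≠ a := fun h => huv (e₁.injective (h1u.trans h.symm))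
  set e₂ := Equiv.swap (e₁ v) b with he₂
  have h2u : e₂ a = a := Equiv.swap_apply_of_ne_of_ne h1v.symm hab
  have h2v : e₂ (e₁ v) = b := by simp [he₂]
  have h2k : e₂ (e₁ k) ≠ b := fun h => hvk (e₁.injective (e₂.injective (h2v.trans h.symm)))
  have h2k' : e₂ (e₁ k) ≠ a := fun h => by
    rw [← h2u, ← h1u] at h
    exact huk (e₁.injective (e₂.injective h)).symm
  refine ⟨e₁.trans (e₂.trans (Equiv.swap (e₂ (e₁ k)) c)), ?_, ?_, ?_⟩
  · rw [Equiv.trans_apply, Equiv.trans_apply, h1u, h2u]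
    exact Equiv.swap_apply_of_ne_of_ne h2k'.symm hac
  · rw [Equiv.trans_apply, Equiv.trans_apply, h2v]
    exact Equiv.swap_apply_of_ne_of_ne h2k.symm hbc
  · simp

theorem exists_equiv_gamma1 {n : ℕ} (hn : 9 ≤ n) (hG : (gamma1 n).IsHermitian)
    {B : Matrix (Fin n) (Fin n) ℝ} {x : Fin n → ℝ} {μ : ℝ}
    (hB0 : ∀ i, B i i = 0) (hBs : ∀ i j, B i j = B j i)
    (hBv : ∀ i j, B i j = 0 ∨ B i j = 1 ∨ B i j = -1) (hx0 : ∀ i, 0 ≤ x i) (hx : x ≠ 0)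
    (hev : ∀ i, ∑ j, B i j * x j = μ * x i) (hμ : lam1 (gamma1 n) hG ≤ μ)
    {u v k : Fin n} (huv : u ≠ v) (huk : u ≠ k) (hvk : v ≠ k) (hneg : B u v = -1)
    (hu : ∀ a, B u a = 1 → a = k) (hv : ∀ a, B v a = 1 → a = k) :
    ∃ e : Fin n ≃ Fin n, ∀ i j, B i j = gamma1 n (e i) (e j) := by
  obtain ⟨e, heu, hev', hek⟩ := exists_equiv_apply_three (a := ⟨0, by omega⟩)
    (b := ⟨1, by omega⟩) (c := ⟨2, by omega⟩) huv huk hvk (by simp) (by simp) (by simp)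
  refine ⟨e, ?_⟩
  have e0 : ∀ i, (e i).val = 0 ↔ i = u := fun i => by
    rw [← e.apply_eq_iff_eq, heu, Fin.ext_iff]
  have e1 : ∀ i, (e i).val = 1 ↔ i = v := fun i => by
    rw [← e.apply_eq_iff_eq, hev', Fin.ext_iff]
  have e2 : ∀ i, (e i).val = 2 ↔ i = k := fun i => by
    rw [← e.apply_eq_iff_eq, hek, Fin.ext_iff]
  have le1 : ∀ i, (e i).val ≤ 1 ↔ i = u ∨ i = v := fun i => by
    rw [← e0, ← e1]
    omega
  have le2 : ∀ i, 2 ≤ (e i).val ↔ i ≠ u ∧ i ≠ v := fun i => by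
    rw [Ne, Ne, ← e0, ← e1]
    omega
  set C : Matrix (Fin n) (Fin n) ℝ := fun i j => gamma1 n (e i) (e j) with hC
  have hCdef : ∀ i j, C i j = if i = j then 0
      else if (i = u ∧ j = v) ∨ (i = v ∧ j = u) then -1
      else if ((i = u ∨ i = v) ∧ j = k) ∨ ((j = u ∨ j = v) ∧ i = k) then 1
      else if (i ≠ u ∧ i ≠ v) ∧ (j ≠ u ∧ j ≠ v) then 1 else 0 := by
    intro i j
    simp only [hC, gamma1, e0, e1, e2, le1, le2, e.apply_eq_iff_eq]
  have hrest : ∀ i j, i ≠ u → i ≠ v → j ≠ u → j ≠ v → i ≠ j → C i j = 1 := by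
    intro i j h1 h2 h3 h4 h5
    simp [hCdef, h1, h2, h3, h4, h5]
  have hnonneg : ∀ i j, i ≠ u → i ≠ v → 0 ≤ C i j := by
    intro i j h1 h2
    rw [hCdef, if_neg (by tauto : ¬ ((i = u ∧ j = v) ∨ (i = v ∧ j = u)))]
    split_ifs <;> norm_num
  have hCu : ∀ j, C u j = (if j = k then 1 else 0) - (if j = v then 1 else 0) := by
    intro j
    rw [hCdef]
    by_cases hju : j = u
    · subst hju
      simp [huv, huk]
    by_cases hjv : j = v
    · subst hjv
      simp [huv, hvk]
    · simp [hju, hjv, Ne.symm hju, huv, huk]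
  have hCv : ∀ j, C v j = (if j = k then 1 else 0) - (if j = u then 1 else 0) := by
    intro j
    rw [hCdef]
    by_cases hjv : j = v
    · subst hjv
      simp [huv.symm, hvk]
    by_cases hju : j = u
    · subst hju
      simp [huv.symm, huk]
    · simp [hju, hjv, Ne.symm hjv, huv.symm, hvk]
  have hCs : ∀ i j, C i j = C j i := by
    intro i j
    have := congrFun (congrFun hG (e i)) (e j)
    simpa [hC] using this.symm
  have hle1 : ∀ i j, B i j ≤ 1 := by
    intro i j
    rcases hBv i j with h | h | h <;> rw [h] <;> norm_num
  have hle0 : ∀ i j, B i j ≠ 1 → B i j ≤ 0 := by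
    intro i j hij
    rcases hBv i j with h | h | h
    · rw [h]
    · exact absurd h hij
    · rw [h]
      norm_num
  have hBu : ∀ j, B u j ≤ C u j := by
    intro j
    rw [hCu]
    by_cases hjk : j = k
    · subst hjk
      simpa [hvk.symm] using hle1 u j
    by_cases hjv : j = v
    · subst hjv
      simp [hneg, hjk]
    · simpa [hjk, hjv] using hle0 u j fun h => hjk (hu j h)
  have hBv' : ∀ j, B v j ≤ C v j := by
    intro j
    rw [hCv]
    by_cases hjk : j = k
    · subst hjk
      simpa [huk.symm] using hle1 v j
    by_cases hju : j = u
    · subst hju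
      simp [hBs v, hneg, hjk]
    · simpa [hjk, hju] using hle0 v j fun h => hjk (hv j h)
  have hBC : ∀ i j, B i j ≤ C i j := by
    intro i j
    by_cases hiu : i = u
    · rw [hiu]
      exact hBu j
    by_cases hiv : i = v
    · rw [hiv]
      exact hBv' j
    by_cases hju : j = u
    · rw [hju, hBs, hCs]
      exact hBu i
    by_cases hjv : j = v
    · rw [hjv, hBs, hCs]
      exact hBv' i
    by_cases hij : i = j
    · rw [hij, hB0, hCdef, if_pos rfl]
    · rw [hrest i j hiu hiv hju hjv hij]
      exact hle1 i j
  have hterm : ∀ i j, B i j * (x i * x j) ≤ C i j * (x i * x j) := fun i j =>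
    mul_le_mul_of_nonneg_right (hBC i j) (mul_nonneg (hx0 i) (hx0 j))
  set y : Fin n → ℝ := fun i => x (e.symm i) with hy
  have hyC : ∀ i, (gamma1 n *ᵥ y) (e i) = ∑ j, C i j * x j := by
    intro i
    rw [Matrix.mulVec, dotProduct, ← Equiv.sum_comp e]
    simp [hy, hC]
  have hyy : y ⬝ᵥ y = ∑ i, x i * x i := by
    rw [dotProduct, ← Equiv.sum_comp e]
    simp [hy]
  have hyCy : y ⬝ᵥ (gamma1 n *ᵥ y) = ∑ i, ∑ j, C i j * (x i * x j) := by
    rw [dotProduct, ← Equiv.sum_comp e]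
    refine Finset.sum_congr rfl fun i _ => ?_
    rw [hyC, Finset.mul_sum]
    refine Finset.sum_congr rfl fun j _ => ?_
    simp only [hy, Equiv.symm_apply_apply]
    ring
  have hxBx : ∑ i, ∑ j, B i j * (x i * x j) = μ * ∑ i, x i * x i := by
    rw [Finset.mul_sum]
    refine Finset.sum_congr rfl fun i _ => ?_
    rw [← mul_assoc, ← hev i, Finset.sum_mul]
    exact Finset.sum_congr rfl fun j _ => by ring
  have hray := dotProduct_mulVec_le_lam1 (gamma1 n) hG y
  have hxx : 0 ≤ ∑ i, x i * x i := Finset.sum_nonneg fun i _ => mul_self_nonneg _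
  have hle : ∑ i, ∑ j, B i j * (x i * x j) ≤ ∑ i, ∑ j, C i j * (x i * x j) :=
    Finset.sum_le_sum fun i _ => Finset.sum_le_sum fun j _ => hterm i j
  have hμx := mul_le_mul_of_nonneg_right hμ hxx
  rw [hyCy, hyy] at hray
  have heq : ∑ i, ∑ j, B i j * (x i * x j) = ∑ i, ∑ j, C i j * (x i * x j) := by linarith
  have heig := mulVec_eq_of_dotProduct_mulVec_eq (gamma1 n) hG y (by
    rw [hyCy, hyy]
    linarith)
  have hn' : (9 : ℝ) ≤ n := by exact_mod_cast hn
  have hpos := pos_of_pendant_triangle_eigenvector (C := C) (ν := lam1 (gamma1 n) hG) hx0 hx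
    (by
      intro i
      rw [← hyC, heig]
      simp [hy])
    (by linarith [lt_lam1_gamma1 hn hG]) huk hvk hrest hnonneg hCu hCv
  intro i j
  rw [Finset.sum_eq_sum_iff_of_le
    (fun i _ => Finset.sum_le_sum fun j _ => hterm i j)] at heq
  have hi := heq i (Finset.mem_univ i)
  rw [Finset.sum_eq_sum_iff_of_le (fun j _ => hterm i j)] at hi
  exact mul_right_cancel₀ (mul_pos (hpos i) (hpos j)).ne' (hi j (Finset.mem_univ j))

end ExtremalGraph

section Main

variable {n : ℕ} {B : Matrix (Fin n) (Fin n) ℝ} {x : Fin n → ℝ} {μ : ℝ}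

theorem exists_path_or_unique_neighbour (hB0 : ∀ i, B i i = 0) (hBs : ∀ i j, B i j = B j i)
    (hBv : ∀ i j, B i j = 0 ∨ B i j = 1 ∨ B i j = -1) (hx0 : ∀ i, 0 ≤ x i) (hx1 : ∀ i, x i ≤ 1)
    {m : Fin n} (hm : x m = 1) (hev : ∀ i, ∑ j, B i j * x j = μ * x i)
    (hμ : (n : ℝ) - 3 < μ) {r : ℕ} (hr4 : 4 ≤ r) (hrn : r ≤ n / 3 + 1) {u v k : Fin n}
    (hneg : B u v = -1) (hk : deficiency B k ≤ 1) (hkv : B k v = 1) :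
    (∃ p : (positiveGraph B).Walk v u, p.IsPath ∧ p.length = r - 1) ∨
      ∀ a, B u a = 1 → a = k := by
  classical
  have hn : 9 ≤ n := by omega
  have hn' : (9 : ℝ) ≤ n := by exact_mod_cast hn
  have hS := lt_sum_of_eigenvector hB0 hBv hx0 hm hev hμ
  have huv : u ≠ v := by
    rintro rfl
    rw [hB0] at hneg
    norm_num at hneg
  have hadj : ∀ {i j}, (positiveGraph B).Adj i j ↔ B i j = 1 := positiveGraph_adj_iff hB0 hBs
  have hnadj : ¬ (positiveGraph B).Adj u v := by
    rw [hadj, hneg]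
    norm_num
  have hu2 : 2 ≤ deficiency B u := two_le_deficiency hB0 (i := v) (by rw [hBs, hneg])
  have hmiss := card_missing_le_deficiency hB0 hBs
  rcases Nat.lt_or_ge 4 r with hr | hr
  · obtain ⟨a, ha⟩ := exists_entry_eq_one_of_neg hBv hx0 hx1 hev (by linarith) hS huv hneg
    have hsum := le_sum_three_sub_deficiency hB0 hBv hx0 hx1 hev hμ (by omega) hS
    have := exists_path_of_sum_le (H := positiveGraph B) (s := r - 2) (by omega)
      (by rw [Fintype.card_fin]; omega) (deficiency B) hmiss (by omega) huv hnadj hu2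
      (two_le_deficiency hB0 hneg) ⟨a, hadj.2 ha⟩ hk (hadj.2 hkv)
    simp only [hadj] at this
    rwa [show r - 2 + 1 = r - 1 by omega] at this
  · obtain rfl : r = 4 := le_antisymm hr hr4
    have := exists_path_of_length_three huv hnadj ((hmiss k).trans hk) (hadj.2 hkv)
    simp only [hadj] at this
    rcases this with h | h | ⟨z, hzk, hkz, huz, huk, hu, hv⟩
    · exact Or.inl h
    · exact Or.inr h
    · exact (false_of_few_positive_neighbours hB0 hBs hBv hx0 hev hμ hn (by linarith) huv
        (hadj.2 huk).ne (hadj.2 huz).ne (hadj.2 hkv).ne'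
        (by
          rintro rfl
          exact hnadj (hadj.2 huz)) hzk hneg hkz hu hv).elim

theorem exists_path_or_equiv_gamma1 (hG : (gamma1 n).IsHermitian) (hB0 : ∀ i, B i i = 0)
    (hBs : ∀ i j, B i j = B j i) (hBv : ∀ i j, B i j = 0 ∨ B i j = 1 ∨ B i j = -1)
    (hx0 : ∀ i, 0 ≤ x i) (hx1 : ∀ i, x i ≤ 1) {m : Fin n} (hm : x m = 1)
    (hev : ∀ i, ∑ j, B i j * x j = μ * x i) (hμ : lam1 (gamma1 n) hG ≤ μ)
    {r : ℕ} (hr4 : 4 ≤ r) (hrn : r ≤ n / 3 + 1) {u v : Fin n} (hneg : B u v = -1) :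
    (∃ p : (positiveGraph B).Walk v u, p.IsPath ∧ p.length = r - 1) ∨
      ∃ e : Fin n ≃ Fin n, ∀ i j, B i j = gamma1 n (e i) (e j) := by
  classical
  have hn : 9 ≤ n := by omega
  have hn' : (9 : ℝ) ≤ n := by exact_mod_cast hn
  have hμ' : (n : ℝ) - 3 < μ := (lt_lam1_gamma1 hn hG).trans_le hμ
  have hS := lt_sum_of_eigenvector hB0 hBv hx0 hm hev hμ'
  have huv : u ≠ v := by
    rintro rfl
    rw [hB0] at hneg
    norm_num at hneg
  have hneg' : B v u = -1 := by rw [hBs, hneg]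
  have hadj : ∀ {i j}, (positiveGraph B).Adj i j ↔ B i j = 1 := positiveGraph_adj_iff hB0 hBs
  obtain ⟨k, hk⟩ := exists_deficiency_le_one hB0 hBv hx0 hev hμ' (by linarith)
  have hku : k ≠ u := by
    rintro rfl
    have := two_le_deficiency hB0 hneg'
    omega
  have hkv : k ≠ v := by
    rintro rfl
    have := two_le_deficiency hB0 hneg
    omega
  by_cases hcon : ∃ p : (positiveGraph B).Walk v u, p.IsPath ∧ p.length = r - 1
  · exact Or.inl hcon
  refine Or.inr ?_
  have hnb_u : B k v = 1 → ∀ a, B u a = 1 → a = k := fun h =>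
    (exists_path_or_unique_neighbour hB0 hBs hBv hx0 hx1 hm hev hμ' hr4 hrn hneg hk
      h).resolve_left hcon
  have hnb_v : B k u = 1 → ∀ a, B v a = 1 → a = k := fun h =>
    (exists_path_or_unique_neighbour hB0 hBs hBv hx0 hx1 hm hev hμ' hr4 hrn hneg' hk
      h).resolve_left fun ⟨p, hp, hl⟩ => hcon ⟨p.reverse, hp.reverse, by simpa using hl⟩
  obtain ⟨a, ha⟩ :=
    exists_entry_eq_one_of_neg hBv hx0 hx1 hev (by linarith) hS huv hneg
  obtain ⟨b, hb⟩ :=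
    exists_entry_eq_one_of_neg hBv hx0 hx1 hev (by linarith) hS huv.symm hneg'
  have hboth : B k u = 1 ∧ B k v = 1 := by
    by_cases hv1 : B k v = 1
    · have := hnb_u hv1 a ha
      subst this
      exact ⟨by rw [hBs, ha], hv1⟩
    · by_cases hu1 : B k u = 1
      · have := hnb_v hu1 b hb
        subst this
        exact absurd (by rw [hBs, hb]) hv1
      · exact absurd (eq_of_card_missing_le_one
          ((card_missing_le_deficiency hB0 hBs k).trans hk) hku.symm (by rwa [hadj]) hkv.symm
          (by rwa [hadj])) huv
  exact exists_equiv_gamma1 hn hG hB0 hBs hBv hx0 (fun h => by simp [h] at hm) hev hμ huv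
    hku.symm hkv.symm hneg (hnb_u hboth.2) (hnb_v hboth.1)

end Main

end Auxiliary

/-- Let `Γ` be an unbalanced signed graph of order `n` and let `r` be an integer with
`4 ≤ r ≤ ⌊n/3⌋ + 1`. If `λ₁(Γ) ≥ λ₁(Γ₁)`, then `Γ` contains a negative cycle of length `r`,
unless `Γ` is switching equivalent (up to isomorphism) to `Γ₁`. -/
theorem stmt15 {n : ℕ} (G : SimpleGraph (Fin n)) [DecidableRel G.Adj]
    (σ : Fin n → Fin n → ℝ)
    (hsym : ∀ i j, σ i j = σ j i)
    (hval : ∀ i j, G.Adj i j → σ i j = 1 ∨ σ i j = -1)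
    (A : Matrix (Fin n) (Fin n) ℝ)
    (hAdef : A = fun i j => if G.Adj i j then σ i j else 0)
    (hA : A.IsHermitian) (hG1 : (gamma1 n).IsHermitian)
    (hunbal : ∃ (v : Fin n) (p : G.Walk v v), p.IsCycle ∧ walkSign σ p = -1)
    (r : ℕ) (hr4 : 4 ≤ r) (hrn : r ≤ n / 3 + 1)
    (hlam : lam1 (gamma1 n) hG1 ≤ lam1 A hA) :
    (∃ (v : Fin n) (p : G.Walk v v), p.IsCycle ∧ p.length = r ∧ walkSign σ p = -1) ∨
    (∃ (e : Fin n ≃ Fin n) (sw : Fin n → ℝ), (∀ v, sw v = 1 ∨ sw v = -1) ∧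
      ∀ i j, A i j = sw i * gamma1 n (e i) (e j) * sw j) := by
  have hn : 9 ≤ n := by omega
  have : NeZero n := ⟨by omega⟩
  obtain ⟨x, hx, hAx⟩ := exists_mulVec_eq_lam1_smul A hA
  set sw : Fin n → ℝ := fun i => if x i < 0 then -1 else 1 with hsw
  have hsw1 : ∀ i, sw i = 1 ∨ sw i = -1 := by
    intro i
    simp only [hsw]
    split_ifs <;> simp
  have hsq : ∀ i, sw i * sw i = 1 := by
    intro i
    rcases hsw1 i with h | h <;> rw [h] <;> norm_num
  have hswx : ∀ i, sw i * x i = |x i| := by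
    intro i
    simp only [hsw]
    split_ifs with h
    · rw [abs_of_neg h, neg_one_mul]
    · rw [abs_of_nonneg (not_lt.1 h), one_mul]
  obtain ⟨m, hm⟩ := Finite.exists_max fun i => |x i|
  have hmpos : 0 < |x m| := by
    obtain ⟨i, hi⟩ := Function.ne_iff.1 hx
    exact (abs_pos.2 hi).trans_le (hm i)
  have hA' : ∀ i j, A i j = if G.Adj i j then σ i j else 0 := fun i j => by rw [hAdef]
  set B : Matrix (Fin n) (Fin n) ℝ := fun i j => sw i * A i j * sw j with hB
  have hAB : ∀ i j, A i j = sw i * B i j * sw j := by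
    intro i j
    simp only [hB]
    linear_combination (-A i j * sw j * sw j) * hsq i - A i j * hsq j
  have hB0 : ∀ i, B i i = 0 := by simp [hB, hA']
  have hBs : ∀ i j, B i j = B j i := by
    intro i j
    simp only [hB, hA', hsym i j, G.adj_comm i j]
    ring
  have hBv : ∀ i j, B i j = 0 ∨ B i j = 1 ∨ B i j = -1 := by
    intro i j
    simp only [hB, hA']
    split_ifs with h
    · rcases hsw1 i with h1 | h1 <;> rcases hsw1 j with h2 | h2 <;>
        rcases hval i j h with h3 | h3 <;> rw [h1, h2, h3] <;> norm_num
    · simp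
  have hrow : ∀ i, ∑ j, B i j * |x j| = lam1 A hA * |x i| := by
    intro i
    have h1 := congrFun hAx i
    rw [Matrix.mulVec, dotProduct, Pi.smul_apply, smul_eq_mul] at h1
    rw [← hswx i, mul_left_comm, ← h1, Finset.mul_sum]
    refine Finset.sum_congr rfl fun j _ => ?_
    rw [← hswx j]
    simp only [hB]
    linear_combination (sw i * A i j * x j) * hsq j
  have hadjB : ∀ i j, (positiveGraph B).Adj i j ↔ B i j = 1 := fun i j =>
    positiveGraph_adj_iff hB0 hBs
  have hle : positiveGraph B ≤ G := by
    intro i j hij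
    by_contra h
    have := (hadjB i j).1 hij
    simp [hB, hA', h] at this
  have hσB : ∀ i j, G.Adj i j → σ i j = sw i * B i j * sw j := by
    intro i j h
    rw [← hAB, hA', if_pos h]
  have hpos : ∀ i j, (positiveGraph B).Adj i j → σ i j = sw i * sw j := by
    intro i j h
    rw [hσB i j (hle h), (hadjB i j).1 h, mul_one]
  obtain ⟨w, c, -, hcneg⟩ := hunbal
  obtain ⟨u, v, huv, huv'⟩ := exists_adj_ne_of_negative_cycle hsq c hcneg
  have hneg : B u v = -1 := by
    rcases hBv u v with h | h | h
    · have h1 := hσB u v huv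
      rw [h] at h1
      rcases hval u v huv with h2 | h2 <;> rw [h2] at h1 <;> norm_num at h1
    · exact absurd (hpos u v ((hadjB u v).2 h)) huv'
    · exact h
  rcases exists_path_or_equiv_gamma1 (x := fun i => |x i| / |x m|) hG1 hB0 hBs hBv
    (fun i => by positivity) (fun i => (div_le_one hmpos).2 (hm i)) (m := m)
    (div_self hmpos.ne')
    (fun i => by
      rw [← mul_div_assoc, ← hrow i, Finset.sum_div]
      exact Finset.sum_congr rfl fun j _ => (mul_div_assoc _ _ _).symm)
    hlam hr4 hrn hneg with ⟨p, hp, hlen⟩ | ⟨e, he⟩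
  · obtain ⟨c, hc, hcl, hcs⟩ := exists_negative_cycle_of_path hle hsq hpos huv
      (fun h => by
        rw [hadjB, hneg] at h
        norm_num at h)
      (by
        rw [hσB u v huv, hneg]
        ring) p hp
    exact Or.inl ⟨u, c, hc, by omega, hcs⟩
  · exact Or.inr ⟨e, sw, hsw1, fun i j => by rw [hAB, he]⟩
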